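/- arXiv:1712.06966 — 4 statements merged into one kernel-verified Lean document; each statement's English description precedes it below -/
import Mathlib

section
/- Let u_- < u_+ be real numbers and s : (u_-, u_+) → ℝ twice differentiable with s''(u) > 0 for all u ∈ (u_-, u_+), such that s' is a bijection from (u_-, u_+) onto ℝ; set u_ME := (s')⁻¹ : ℝ → (u_-, u_+). Let g : ℝ × ℝ → ℝ be differentiable with, everywhere, ∂g/∂u_ℓ ≥ 0, ∂g/∂u_r ≤ 0 and ∂g/∂u_ℓ − ∂g/∂u_r ≤ M for some M ≥ 0. Let c > 0, γ ≥ 1 and Δ ∈ ℝ satisfy γ·c·M ≤ 1 and s''(u_ME(Λ + Δ)) ≤ γ·s''(u_ME(Λ)) for all Λ ∈ ℝ. Then the function H(a, b, d) := u_ME(b + Δ) − c·(g(u_ME(b), u_ME(d)) − g(u_ME(a), u_ME(b))) is monotonically nondecreasing in each of its three arguments, and consequently u_- < H(a, b, d) < u_+ for all a, b, d ∈ ℝ. -/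
/-- A right inverse of `f`, with values in an open interval on which `f` has positive derivative,
is strictly monotone. -/
theorem strictMono_of_rightInverse_of_deriv_pos {f v : ℝ → ℝ} {l r : ℝ}
    (hf : ∀ u ∈ Set.Ioo l r, DifferentiableAt ℝ f u)
    (hf' : ∀ u ∈ Set.Ioo l r, 0 < deriv f u)
    (hv : ∀ x, v x ∈ Set.Ioo l r ∧ f (v x) = x) : StrictMono v := by
  have hmono : StrictMonoOn f (Set.Ioo l r) :=
    strictMonoOn_of_deriv_pos (convex_Ioo l r)
      (fun u hu => (hf u hu).continuousAt.continuousWithinAt)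
      (fun u hu => hf' u (interior_subset hu))
  intro x y hxy
  rw [← hmono.lt_iff_lt (hv x).1 (hv y).1, (hv x).2, (hv y).2]
  exact hxy

/-- Inverse function theorem for a right inverse of `f` with values in an open interval on which
`f` has positive derivative. -/
theorem hasDerivAt_of_rightInverse_of_deriv_pos {f v : ℝ → ℝ} {l r : ℝ}
    (hf : ∀ u ∈ Set.Ioo l r, DifferentiableAt ℝ f u)
    (hf' : ∀ u ∈ Set.Ioo l r, 0 < deriv f u)
    (hv : ∀ x, v x ∈ Set.Ioo l r ∧ f (v x) = x) (x : ℝ) :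
    HasDerivAt v (deriv f (v x))⁻¹ x := by
  have hmono : StrictMonoOn f (Set.Ioo l r) :=
    strictMonoOn_of_deriv_pos (convex_Ioo l r)
      (fun u hu => (hf u hu).continuousAt.continuousWithinAt)
      (fun u hu => hf' u (interior_subset hu))
  have himage : Set.Ioo l r ⊆ v '' Set.univ := fun u hu =>
    ⟨f u, Set.mem_univ _, hmono.injOn (hv (f u)).1 hu (hv (f u)).2⟩
  have hcont : ContinuousAt v x :=
    ((strictMono_of_rightInverse_of_deriv_pos hf hf' hv).strictMonoOn
      Set.univ).continuousAt_of_image_mem_nhds Filter.univ_mem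
        (Filter.mem_of_superset (isOpen_Ioo.mem_nhds (hv x).1) himage)
  exact (hf _ (hv x).1).hasDerivAt.of_local_left_inverse hcont (hf' _ (hv x).1).ne'
    (Filter.Eventually.of_forall fun y => (hv y).2)

/-- Modified-CFL realizability theorem (first order): under the stopping criterion
`s''(u_ME(Λ+Δ)) ≤ γ s''(u_ME(Λ))` and the modified CFL condition `γ c M ≤ 1`, the
first-order IPM update function is monotone in each argument and hence takes
values in `(u_-, u_+)`. -/
theorem modified_CFL_realizability
    (um up : ℝ) (hlt : um < up)
    (s : ℝ → ℝ)
    (hs1 : ∀ u ∈ Set.Ioo um up, DifferentiableAt ℝ s u)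
    (hs2 : ∀ u ∈ Set.Ioo um up, DifferentiableAt ℝ (deriv s) u)
    (hs3 : ∀ u ∈ Set.Ioo um up, 0 < deriv (deriv s) u)
    (hbij : Set.BijOn (deriv s) (Set.Ioo um up) Set.univ)
    (uME : ℝ → ℝ)
    (huME : ∀ Λ : ℝ, uME Λ ∈ Set.Ioo um up ∧ deriv s (uME Λ) = Λ)
    (g : ℝ → ℝ → ℝ)
    (hg : Differentiable ℝ (fun p : ℝ × ℝ => g p.1 p.2))
    (M : ℝ) (hM : 0 ≤ M)
    (hgl : ∀ a b : ℝ, 0 ≤ deriv (fun x => g x b) a)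
    (hgr : ∀ a b : ℝ, deriv (fun y => g a y) b ≤ 0)
    (hspread : ∀ a b a' b' : ℝ,
      deriv (fun x => g x b) a - deriv (fun y => g a' y) b' ≤ M)
    (c γ Δ : ℝ) (hc : 0 < c) (hγ : 1 ≤ γ) (hcfl : γ * c * M ≤ 1)
    (hratio : ∀ Λ : ℝ,
      deriv (deriv s) (uME (Λ + Δ)) ≤ γ * deriv (deriv s) (uME Λ))
    (H : ℝ → ℝ → ℝ → ℝ)
    (hH : ∀ a b d : ℝ,
      H a b d = uME (b + Δ) - c * (g (uME b) (uME d) - g (uME a) (uME b))) :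
    (∀ b d : ℝ, Monotone (fun a => H a b d)) ∧
    (∀ a d : ℝ, Monotone (fun b => H a b d)) ∧
    (∀ a b : ℝ, Monotone (fun d => H a b d)) ∧
    (∀ a b d : ℝ, H a b d ∈ Set.Ioo um up) := by
  have hmono : StrictMono uME := strictMono_of_rightInverse_of_deriv_pos hs2 hs3 huME
  have hderiv := hasDerivAt_of_rightInverse_of_deriv_pos hs2 hs3 huME
  have hdl : ∀ y, Differentiable ℝ (fun x => g x y) := fun y =>
    hg.comp (differentiable_id.prodMk (differentiable_const y))
  have hdr : ∀ x, Differentiable ℝ (fun y => g x y) := fun x =>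
    hg.comp ((differentiable_const x).prodMk differentiable_id)
  have hgl_mono : ∀ y, Monotone (fun x => g x y) := fun y =>
    monotone_of_deriv_nonneg (hdl y) fun x => hgl x y
  have hgr_anti : ∀ x, Antitone (fun y => g x y) := fun x =>
    antitone_of_deriv_nonpos (hdr x) fun y => hgr x y
  have hleft : ∀ b d : ℝ, Monotone (fun a => H a b d) := by
    intro b d a a' h
    simp only [hH]
    have := mul_le_mul_of_nonneg_left (hgl_mono (uME b) (hmono.monotone h)) hc.le
    linarith
  have hright : ∀ a b : ℝ, Monotone (fun d => H a b d) := by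
    intro a b d d' h
    simp only [hH]
    have := mul_le_mul_of_nonneg_left (hgr_anti (uME b) (hmono.monotone h)) hc.le
    linarith
  have hmid : ∀ a d : ℝ, Monotone (fun b => H a b d) := by
    intro a d
    have hH' : ∀ b, HasDerivAt (fun b => H a b d)
        ((deriv (deriv s) (uME (b + Δ)))⁻¹ -
          c * (deriv (fun x => g x (uME d)) (uME b) * (deriv (deriv s) (uME b))⁻¹ -
            deriv (fun y => g (uME a) y) (uME b) * (deriv (deriv s) (uME b))⁻¹)) b := by
      intro b
      simp only [hH]
      exact ((hderiv (b + Δ)).comp_add_const b Δ).sub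
        ((((hdl (uME d) (uME b)).hasDerivAt.comp b (hderiv b)).sub
          ((hdr (uME a) (uME b)).hasDerivAt.comp b (hderiv b))).const_mul c)
    refine monotone_of_deriv_nonneg (fun b => (hH' b).differentiableAt) fun b => ?_
    rw [(hH' b).deriv, ← sub_mul, ← mul_assoc, sub_nonneg]
    have hp := hs3 _ (huME b).1
    have hq := hs3 _ (huME (b + Δ)).1
    have hcM := mul_le_mul_of_nonneg_left (hspread (uME b) (uME d) (uME a) (uME b)) hc.le
    rw [← div_eq_mul_inv, div_le_iff₀ hp, inv_mul_eq_div, le_div_iff₀ hq]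
    calc _ ≤ c * M * deriv (deriv s) (uME (b + Δ)) := mul_le_mul_of_nonneg_right hcM hq.le
      _ ≤ c * M * (γ * deriv (deriv s) (uME b)) :=
        mul_le_mul_of_nonneg_left (hratio b) (mul_nonneg hc.le hM)
      _ = γ * c * M * deriv (deriv s) (uME b) := by ring
      _ ≤ deriv (deriv s) (uME b) := mul_le_of_le_one_left hp.le hcfl
  have hle : ∀ {a b d a' b' d' : ℝ}, a ≤ a' → b ≤ b' → d ≤ d' → H a b d ≤ H a' b' d' :=
    fun {a b d a' b' d'} ha hb hd =>
      (hleft b d ha).trans ((hmid a' d hb).trans (hright a' b' hd))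
  have hdiag : ∀ x, H x x x = uME (x + Δ) := fun x => by simp [hH]
  refine ⟨hleft, hmid, hright, fun a b d => ⟨?_, ?_⟩⟩
  · refine (huME (min a (min b d) + Δ)).1.1.trans_le ?_
    rw [← hdiag]
    exact hle (by simp) (by simp) (by simp)
  · refine lt_of_le_of_lt ?_ (huME (max a (max b d) + Δ)).1.2
    rw [← hdiag]
    exact hle (by simp) (by simp) (by simp)
end

section
/- Let E be a (real) normed vector space, c ≥ 0, τ ≥ 0 and K ≥ 0. Let F : E × E → E satisfy ‖F(a, b) − F(a', b)‖ ≤ K‖a − a'‖ and ‖F(a, b) − F(a, b')‖ ≤ K‖b − b'‖ for all a, a', b, b' ∈ E. Let u₁, u₂, u₃ and ū₁, ū₂, ū₃ be elements of E with ‖u_i − ū_i‖ ≤ τ for i = 1, 2, 3. Then ‖(u₂ − c·(F(u₂, u₃) − F(u₁, u₂))) − (ū₂ − c·(F(ū₂, ū₃) − F(ū₁, ū₂)))‖ ≤ (1 + 4cK)·τ. -/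
/-- A map that is `K`-Lipschitz in each argument moves by at most `2 K τ` when both
arguments move by at most `τ`. -/
theorem norm_sub_le_of_lipschitz_each_argument
    {E G : Type*} [SeminormedAddCommGroup E] [SeminormedAddCommGroup G]
    {τ K : ℝ} (hK : 0 ≤ K) {F : E → E → G}
    (hF1 : ∀ a a' b : E, ‖F a b - F a' b‖ ≤ K * ‖a - a'‖)
    (hF2 : ∀ a b b' : E, ‖F a b - F a b'‖ ≤ K * ‖b - b'‖)
    {a a' b b' : E} (ha : ‖a - a'‖ ≤ τ) (hb : ‖b - b'‖ ≤ τ) :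
    ‖F a b - F a' b'‖ ≤ 2 * K * τ :=
  calc ‖F a b - F a' b'‖ ≤ ‖F a b - F a' b‖ + ‖F a' b - F a' b'‖ :=
        norm_sub_le_norm_sub_add_norm_sub _ _ _
    _ ≤ K * ‖a - a'‖ + K * ‖b - b'‖ := add_le_add (hF1 _ _ _) (hF2 _ _ _)
    _ ≤ K * τ + K * τ := by gcongr
    _ = 2 * K * τ := by ring

/-- Error estimate for the modified IPM scheme: if the numerical flux `F` is
Lipschitz in each argument with constant `K` and the recalculated moments `v i`
differ from the exact moments `u i` by at most `τ`, then the one-step difference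
between the exact and the modified update is at most `(1 + 4 c K) τ`. -/
theorem modified_scheme_one_step_error
    {E : Type*} [NormedAddCommGroup E] [NormedSpace ℝ E]
    (c τ K : ℝ) (hc : 0 ≤ c) (hτ : 0 ≤ τ) (hK : 0 ≤ K)
    (F : E → E → E)
    (hF1 : ∀ a a' b : E, ‖F a b - F a' b‖ ≤ K * ‖a - a'‖)
    (hF2 : ∀ a b b' : E, ‖F a b - F a b'‖ ≤ K * ‖b - b'‖)
    (u₁ u₂ u₃ v₁ v₂ v₃ : E)
    (h1 : ‖u₁ - v₁‖ ≤ τ) (h2 : ‖u₂ - v₂‖ ≤ τ) (h3 : ‖u₃ - v₃‖ ≤ τ) :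
    ‖(u₂ - c • (F u₂ u₃ - F u₁ u₂)) - (v₂ - c • (F v₂ v₃ - F v₁ v₂))‖
      ≤ (1 + 4 * c * K) * τ := by
  have hr := norm_sub_le_of_lipschitz_each_argument hK hF1 hF2 h2 h3
  have hl := norm_sub_le_of_lipschitz_each_argument hK hF1 hF2 h1 h2
  calc ‖(u₂ - c • (F u₂ u₃ - F u₁ u₂)) - (v₂ - c • (F v₂ v₃ - F v₁ v₂))‖
      = ‖(u₂ - v₂) - c • ((F u₂ u₃ - F v₂ v₃) - (F u₁ u₂ - F v₁ v₂))‖ := by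
        congr 1
        module
    _ ≤ ‖u₂ - v₂‖ + c * ‖(F u₂ u₃ - F v₂ v₃) - (F u₁ u₂ - F v₁ v₂)‖ := by
        refine (norm_sub_le _ _).trans_eq ?_
        rw [norm_smul_of_nonneg hc]
    _ ≤ τ + c * (2 * K * τ + 2 * K * τ) := by
        gcongr
        exact norm_sub_le_of_le hr hl
    _ = (1 + 4 * c * K) * τ := by ring
end

section
/- Let u_- < u_+ be real numbers and s : (u_-, u_+) → ℝ twice differentiable with s''(u) > 0 for all u ∈ (u_-, u_+), such that s' is a bijection from (u_-, u_+) onto ℝ; set u_ME := (s')⁻¹ : ℝ → (u_-, u_+). Let g : ℝ × ℝ → ℝ be differentiable with, everywhere, ∂g/∂u_ℓ ≥ 0, ∂g/∂u_r ≤ 0 and ∂g/∂u_ℓ − ∂g/∂u_r ≤ M for some M ≥ 0. Let c > 0, γ̃ ≥ 1 and Δ⁺, Δ⁻ ∈ ℝ satisfy 2·γ̃·c·M ≤ 1 and s''(u_ME(Λ + Δ^±)) ≤ γ̃·s''(u_ME(Λ)) for all Λ ∈ ℝ and both signs. Then for each Δ ∈ {Δ⁺, Δ⁻}, the function H_Δ(a,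 b, d) := u_ME(b + Δ) − 2c·(g(u_ME(b), u_ME(d)) − g(u_ME(a), u_ME(b))) is monotonically nondecreasing in each of its three arguments, and u_- < H_Δ(a, b, d) < u_+ for all a, b, d ∈ ℝ. Consequently, any average (1/2)(H_{Δ⁻}(a, b, d) + H_{Δ⁺}(a', b', d')) also lies in (u_-, u_+). -/
/-- A right inverse, with values in an open interval, of a function with positive derivative on
that interval is strictly increasing. -/
theorem strictMono_of_rightInverse_of_deriv_pos_s8 {f φ : ℝ → ℝ} {p q : ℝ}
    (hd : ∀ u ∈ Set.Ioo p q, DifferentiableAt ℝ f u)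
    (hpos : ∀ u ∈ Set.Ioo p q, 0 < deriv f u)
    (hφ : ∀ x, φ x ∈ Set.Ioo p q ∧ f (φ x) = x) : StrictMono φ := by
  have hf : StrictMonoOn f (Set.Ioo p q) :=
    strictMonoOn_of_deriv_pos (convex_Ioo p q)
      (fun u hu => (hd u hu).continuousAt.continuousWithinAt)
      (by simpa only [interior_Ioo] using hpos)
  intro x y hxy
  rw [← hf.lt_iff_lt (hφ x).1 (hφ y).1, (hφ x).2, (hφ y).2]
  exact hxy

/-- The inverse function rule for a right inverse, with values in an open interval, of a function
with positive derivative on that interval. -/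
theorem hasDerivAt_of_rightInverse_of_deriv_pos_s8 {f φ : ℝ → ℝ} {p q : ℝ}
    (hd : ∀ u ∈ Set.Ioo p q, DifferentiableAt ℝ f u)
    (hpos : ∀ u ∈ Set.Ioo p q, 0 < deriv f u)
    (hinj : Set.InjOn f (Set.Ioo p q))
    (hφ : ∀ x, φ x ∈ Set.Ioo p q ∧ f (φ x) = x) (x : ℝ) :
    HasDerivAt φ (deriv f (φ x))⁻¹ x := by
  have himage : φ '' Set.univ ∈ nhds (φ x) := by
    refine Filter.mem_of_superset (isOpen_Ioo.mem_nhds (hφ x).1) fun u hu => ?_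
    exact ⟨f u, trivial, hinj (hφ _).1 hu (hφ _).2⟩
  have hcont : ContinuousAt φ x :=
    continuousAt_of_monotoneOn_of_image_mem_nhds
      ((strictMono_of_rightInverse_of_deriv_pos_s8 hd hpos hφ).monotone.monotoneOn _)
      Filter.univ_mem himage
  exact (hd _ (hφ x).1).hasDerivAt.of_local_left_inverse hcont (hpos _ (hφ x).1).ne'
    (Filter.Eventually.of_forall fun y => (hφ y).2)


/-- Second-order realizability theorem (pointwise content): under the time-step
restriction `2 γ̃ c M ≤ 1` and the optimization-error ratio bounds, each of the two
first-order-type updates `H_Δ` (with doubled CFL ratio `2c`) is monotone in each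
argument and takes values in `(u_-, u_+)`; consequently any average of two such
values lies in `(u_-, u_+)`. -/
theorem secondOrder_realizability
    (um up : ℝ) (hlt : um < up)
    (s : ℝ → ℝ)
    (hs1 : ∀ u ∈ Set.Ioo um up, DifferentiableAt ℝ s u)
    (hs2 : ∀ u ∈ Set.Ioo um up, DifferentiableAt ℝ (deriv s) u)
    (hs3 : ∀ u ∈ Set.Ioo um up, 0 < deriv (deriv s) u)
    (hbij : Set.BijOn (deriv s) (Set.Ioo um up) Set.univ)
    (uME : ℝ → ℝ)
    (huME : ∀ Λ : ℝ, uME Λ ∈ Set.Ioo um up ∧ deriv s (uME Λ) = Λ)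
    (g : ℝ → ℝ → ℝ)
    (hg : Differentiable ℝ (fun p : ℝ × ℝ => g p.1 p.2))
    (M : ℝ) (hM : 0 ≤ M)
    (hgl : ∀ a b : ℝ, 0 ≤ deriv (fun x => g x b) a)
    (hgr : ∀ a b : ℝ, deriv (fun y => g a y) b ≤ 0)
    (hspread : ∀ a b a' b' : ℝ,
      deriv (fun x => g x b) a - deriv (fun y => g a' y) b' ≤ M)
    (c γ Δp Δm : ℝ) (hc : 0 < c) (hγ : 1 ≤ γ) (hcfl : 2 * γ * c * M ≤ 1)
    (hratioP : ∀ Λ : ℝ,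
      deriv (deriv s) (uME (Λ + Δp)) ≤ γ * deriv (deriv s) (uME Λ))
    (hratioM : ∀ Λ : ℝ,
      deriv (deriv s) (uME (Λ + Δm)) ≤ γ * deriv (deriv s) (uME Λ))
    (H : ℝ → ℝ → ℝ → ℝ → ℝ)
    (hH : ∀ Δ a b d : ℝ,
      H Δ a b d = uME (b + Δ) - 2 * c * (g (uME b) (uME d) - g (uME a) (uME b))) :
    (∀ Δ ∈ ({Δp, Δm} : Set ℝ),
      (∀ b d : ℝ, Monotone (fun a => H Δ a b d)) ∧
      (∀ a d : ℝ, Monotone (fun b => H Δ a b d)) ∧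
      (∀ a b : ℝ, Monotone (fun d => H Δ a b d)) ∧
      (∀ a b d : ℝ, H Δ a b d ∈ Set.Ioo um up)) ∧
    (∀ a b d a' b' d' : ℝ,
      (1 / 2) * (H Δm a b d + H Δp a' b' d') ∈ Set.Ioo um up) := by
  have hmono : Monotone uME :=
    (strictMono_of_rightInverse_of_deriv_pos_s8 hs2 hs3 huME).monotone
  have hderiv : ∀ x, HasDerivAt uME (deriv (deriv s) (uME x))⁻¹ x :=
    hasDerivAt_of_rightInverse_of_deriv_pos_s8 hs2 hs3 hbij.injOn huME
  have hdl : ∀ b, Differentiable ℝ (fun x => g x b) := fun b =>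
    hg.comp (differentiable_id.prodMk (differentiable_const b))
  have hdr : ∀ a, Differentiable ℝ (fun y => g a y) := fun a =>
    hg.comp ((differentiable_const a).prodMk differentiable_id)
  have hgmono : ∀ b, Monotone (fun x => g x b) := fun b =>
    monotone_of_deriv_nonneg (hdl b) fun a => hgl a b
  have hganti : ∀ a, Antitone (fun y => g a y) := fun a =>
    antitone_of_deriv_nonpos (hdr a) fun b => hgr a b
  have key : ∀ Δ ∈ ({Δp, Δm} : Set ℝ),
      (∀ b d : ℝ, Monotone (fun a => H Δ a b d)) ∧
      (∀ a d : ℝ, Monotone (fun b => H Δ a b d)) ∧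
      (∀ a b : ℝ, Monotone (fun d => H Δ a b d)) ∧
      (∀ a b d : ℝ, H Δ a b d ∈ Set.Ioo um up) := by
    intro Δ hΔ
    have hratio : ∀ Λ, deriv (deriv s) (uME (Λ + Δ)) ≤ γ * deriv (deriv s) (uME Λ) := by
      rcases hΔ with rfl | rfl
      exacts [hratioP, hratioM]
    have hleft : ∀ b d : ℝ, Monotone (fun a => H Δ a b d) := by
      intro b d x y hxy
      simp only [hH]
      have h : g (uME x) (uME b) ≤ g (uME y) (uME b) := hgmono _ (hmono hxy)
      gcongr
    have hright : ∀ a b : ℝ, Monotone (fun d => H Δ a b d) := by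
      intro a b x y hxy
      simp only [hH]
      have h : g (uME b) (uME y) ≤ g (uME b) (uME x) := hganti _ (hmono hxy)
      gcongr
    have hmid : ∀ a d : ℝ, Monotone (fun b => H Δ a b d) := by
      intro a d
      simp only [hH]
      have hD : ∀ b, HasDerivAt
          (fun b => uME (b + Δ) - 2 * c * (g (uME b) (uME d) - g (uME a) (uME b)))
          ((deriv (deriv s) (uME (b + Δ)))⁻¹ - 2 * c *
            (deriv (fun x => g x (uME d)) (uME b) * (deriv (deriv s) (uME b))⁻¹ -
              deriv (fun y => g (uME a) y) (uME b) * (deriv (deriv s) (uME b))⁻¹)) b :=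
        fun b => ((hderiv (b + Δ)).comp_add_const b Δ).sub
          ((((hdl (uME d) (uME b)).hasDerivAt.comp b (hderiv b)).sub
            ((hdr (uME a) (uME b)).hasDerivAt.comp b (hderiv b))).const_mul (2 * c))
      refine monotone_of_deriv_nonneg (fun b => (hD b).differentiableAt) fun b => ?_
      rw [(hD b).deriv, ← sub_mul, ← mul_assoc, ← div_eq_mul_inv, sub_nonneg]
      have hpos := hs3 _ (huME b).1
      have hpos' := hs3 _ (huME (b + Δ)).1
      have hsp := hspread (uME b) (uME d) (uME a) (uME b)
      have hγ0 : 0 < γ := by linarith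
      rw [← one_div, div_le_div_iff₀ hpos hpos', one_mul]
      calc _ ≤ 2 * c * M * (γ * deriv (deriv s) (uME b)) := by
            gcongr
            exact hratio b
        _ = 2 * γ * c * M * deriv (deriv s) (uME b) := by ring
        _ ≤ deriv (deriv s) (uME b) := mul_le_of_le_one_left hpos.le hcfl
    have hdiag : ∀ t, H Δ t t t = uME (t + Δ) := fun t => by simp [hH]
    refine ⟨hleft, hmid, hright, fun a b d => ⟨?_, ?_⟩⟩
    · obtain ⟨t, hta, htb, htd⟩ : ∃ t, t ≤ a ∧ t ≤ b ∧ t ≤ d :=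
        ⟨min a (min b d), by simp⟩
      calc um < H Δ t t t := (huME (t + Δ)).1.1.trans_eq (hdiag t).symm
        _ ≤ H Δ a t t := hleft t t hta
        _ ≤ H Δ a b t := hmid a t htb
        _ ≤ H Δ a b d := hright a b htd
    · obtain ⟨t, hta, htb, htd⟩ : ∃ t, a ≤ t ∧ b ≤ t ∧ d ≤ t :=
        ⟨max a (max b d), by simp⟩
      calc H Δ a b d ≤ H Δ a b t := hright a b htd
        _ ≤ H Δ a t t := hmid a t htb
        _ ≤ H Δ t t t := hleft t t hta
        _ < up := (hdiag t).trans_lt (huME (t + Δ)).1.2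
  refine ⟨key, fun a b d a' b' d' => ?_⟩
  obtain ⟨h₁, h₂⟩ := (key Δm (by simp)).2.2.2 a b d
  obtain ⟨h₃, h₄⟩ := (key Δp (by simp)).2.2.2 a' b' d'
  constructor <;> linarith
end

section
/- Let u_- < u_+ be real numbers and s : (u_-, u_+) → ℝ twice differentiable with s''(u) > 0 for all u ∈ (u_-, u_+), such that s' is a bijection from (u_-, u_+) onto ℝ; set u_ME := (s')⁻¹ : ℝ → (u_-, u_+). Let g : ℝ × ℝ → ℝ be differentiable with, everywhere, ∂g/∂u_ℓ ≥ 0, ∂g/∂u_r ≤ 0 and ∂g/∂u_ℓ − ∂g/∂u_r ≤ M for some M ≥ 0, and let c > 0 satisfy c·M ≤ 1. Then the function H̃(a, b, d) := u_ME(b) − c·(g(u_ME(b), u_ME(d)) − g(u_ME(a), u_ME(b))) is monotonically nondecreasing in each of its three arguments, and u_- < H̃(a, b, d) < u_+ for all a, b, d ∈ ℝ. -/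
/-- A right inverse, with values in an interval, of a function with positive derivative there
is monotone. -/
theorem monotone_of_rightInverse_of_deriv_pos {a b : ℝ} {f r : ℝ → ℝ}
    (hf : ∀ u ∈ Set.Ioo a b, DifferentiableAt ℝ f u)
    (hpos : ∀ u ∈ Set.Ioo a b, 0 < deriv f u)
    (hr : ∀ y, r y ∈ Set.Ioo a b ∧ f (r y) = y) : Monotone r := by
  have hmono : StrictMonoOn f (Set.Ioo a b) :=
    strictMonoOn_of_deriv_pos (convex_Ioo a b)
      (fun u hu => (hf u hu).continuousAt.continuousWithinAt)
      (fun u hu => hpos u (interior_subset hu))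
  intro x y hxy
  rw [← hmono.le_iff_le (hr x).1 (hr y).1, (hr x).2, (hr y).2]
  exact hxy

/-- If the spread of the partial derivatives of `g` is at most `M` and `c * M ≤ 1`, the
conservative update is monotone in the value of the central cell. -/
theorem monotone_central_update {g : ℝ → ℝ → ℝ} {M c : ℝ}
    (hl : ∀ b, Differentiable ℝ fun x => g x b) (hr : ∀ a, Differentiable ℝ fun y => g a y)
    (hspread : ∀ a b a' b' : ℝ,
      deriv (fun x => g x b) a - deriv (fun y => g a' y) b' ≤ M)
    (hc : 0 ≤ c) (hcfl : c * M ≤ 1) (v w : ℝ) :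
    Monotone fun u => u - c * (g u w - g v u) := by
  have hd : ∀ u, HasDerivAt (fun u => u - c * (g u w - g v u))
      (1 - c * (deriv (fun x => g x w) u - deriv (fun y => g v y) u)) u := fun u =>
    (hasDerivAt_id u).sub (((hl w u).hasDerivAt.sub (hr v u).hasDerivAt).const_mul c)
  refine monotone_of_deriv_nonneg (fun u => (hd u).differentiableAt) fun u => ?_
  rw [(hd u).deriv]
  linarith [mul_le_mul_of_nonneg_left (hspread u w v u) hc]


/-- Realizability of the modified IPM scheme (moments recalculated from the
inexact dual state): the update function `H̃` built without the optimization
error is monotone in each argument under the original CFL condition `c M ≤ 1`,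
and hence takes values in `(u₋, u₊)`. -/
theorem modified_scheme_realizability
    (um up : ℝ) (hlt : um < up)
    (s : ℝ → ℝ)
    (hs1 : ∀ u ∈ Set.Ioo um up, DifferentiableAt ℝ s u)
    (hs2 : ∀ u ∈ Set.Ioo um up, DifferentiableAt ℝ (deriv s) u)
    (hs3 : ∀ u ∈ Set.Ioo um up, 0 < deriv (deriv s) u)
    (hbij : Set.BijOn (deriv s) (Set.Ioo um up) Set.univ)
    (uME : ℝ → ℝ)
    (huME : ∀ Λ : ℝ, uME Λ ∈ Set.Ioo um up ∧ deriv s (uME Λ) = Λ)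
    (g : ℝ → ℝ → ℝ)
    (hg : Differentiable ℝ (fun p : ℝ × ℝ => g p.1 p.2))
    (M : ℝ) (hM : 0 ≤ M)
    (hgl : ∀ a b : ℝ, 0 ≤ deriv (fun x => g x b) a)
    (hgr : ∀ a b : ℝ, deriv (fun y => g a y) b ≤ 0)
    (hspread : ∀ a b a' b' : ℝ,
      deriv (fun x => g x b) a - deriv (fun y => g a' y) b' ≤ M)
    (c : ℝ) (hc : 0 < c) (hcfl : c * M ≤ 1)
    (H : ℝ → ℝ → ℝ → ℝ)
    (hH : ∀ a b d : ℝ,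
      H a b d = uME b - c * (g (uME b) (uME d) - g (uME a) (uME b))) :
    (∀ b d : ℝ, Monotone (fun a => H a b d)) ∧
    (∀ a d : ℝ, Monotone (fun b => H a b d)) ∧
    (∀ a b : ℝ, Monotone (fun d => H a b d)) ∧
    (∀ a b d : ℝ, H a b d ∈ Set.Ioo um up) := by
  have hu : Monotone uME := monotone_of_rightInverse_of_deriv_pos hs2 hs3 huME
  have hl : ∀ b, Differentiable ℝ fun x => g x b := fun b =>
    hg.comp (differentiable_id.prodMk (differentiable_const b))
  have hr : ∀ a, Differentiable ℝ fun y => g a y := fun a =>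
    hg.comp ((differentiable_const a).prodMk differentiable_id)
  have h₁ : ∀ b d : ℝ, Monotone fun a => H a b d := by
    intro b d x y hxy
    have h := monotone_of_deriv_nonneg (hl (uME b)) (hgl · (uME b)) (hu hxy)
    simp only [hH] at h ⊢
    linarith [mul_le_mul_of_nonneg_left h hc.le]
  have h₂ : ∀ a d : ℝ, Monotone fun b => H a b d := by
    intro a d x y hxy
    simpa only [hH] using
      monotone_central_update hl hr hspread hc.le hcfl (uME a) (uME d) (hu hxy)
  have h₃ : ∀ a b : ℝ, Monotone fun d => H a b d := by
    intro a b x y hxy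
    have h := antitone_of_deriv_nonpos (hr (uME b)) (hgr (uME b)) (hu hxy)
    simp only [hH] at h ⊢
    linarith [mul_le_mul_of_nonneg_left h hc.le]
  have hdiag : ∀ x, H x x x = uME x := fun x => by simp [hH]
  have hle : ∀ {a b d a' b' d' : ℝ}, a ≤ a' → b ≤ b' → d ≤ d' → H a b d ≤ H a' b' d' :=
    fun ha hb hd => (h₁ _ _ ha).trans ((h₂ _ _ hb).trans (h₃ _ _ hd))
  refine ⟨h₁, h₂, h₃, fun a b d => ⟨?_, ?_⟩⟩
  · calc um < uME (min a (min b d)) := (huME _).1.1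
      _ = H _ _ _ := (hdiag _).symm
      _ ≤ H a b d := hle (by simp) (by simp) (by simp)
  · calc H a b d ≤ H (max a (max b d)) (max a (max b d)) (max a (max b d)) :=
          hle (by simp) (by simp) (by simp)
      _ = uME (max a (max b d)) := hdiag _
      _ < up := (huME _).1.2
end
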